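/- Let N, P ∈ ℕ with P ≥ 1, let α_1, …, α_P ∈ ℝ^N be pairwise distinct, and define W : ℝ^N → ℝ by W(u) := ∏_{i=1}^P |u − α_i|². Then there exist smooth functions W_conv, W_pert : ℝ^N → [0,∞) such that W = W_conv + W_pert, W_conv is convex, and the Hessian of W_pert is uniformly bounded: sup_{u ∈ ℝ^N} ‖∇²W_pert(u)‖ < ∞. -/

import Mathlib

open MeasureTheory

/-- The primitive of `Real.smoothTransition`: a smooth convex ramp vanishing on `(-∞, 0]` and of
slope one on `[1, ∞)`. -/
noncomputable def smoothRamp (s : ℝ) : ℝ := ∫ r in (0 : ℝ)..s, Real.smoothTransition r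

namespace smoothRamp

theorem hasDerivAt (s : ℝ) : HasDerivAt smoothRamp (Real.smoothTransition s) s :=
  (Real.smoothTransition.continuous.integral_hasStrictDerivAt 0 s).hasDerivAt

theorem deriv_eq : deriv smoothRamp = Real.smoothTransition :=
  funext fun s => (hasDerivAt s).deriv

theorem contDiff : ContDiff ℝ (⊤ : ℕ∞) smoothRamp := by
  refine contDiff_infty_iff_deriv.2 ⟨fun s => (hasDerivAt s).differentiableAt, ?_⟩
  rw [deriv_eq]
  exact Real.smoothTransition.contDiff

theorem monotone : Monotone smoothRamp := by
  refine monotone_of_deriv_nonneg (fun s => (hasDerivAt s).differentiableAt) fun s => ?_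
  rw [deriv_eq]
  exact Real.smoothTransition.nonneg s

theorem eq_zero_of_nonpos {s : ℝ} (hs : s ≤ 0) : smoothRamp s = 0 := by
  have h : Set.EqOn Real.smoothTransition (fun _ => (0 : ℝ)) (Set.uIcc 0 s) := fun r hr => by
    rw [Set.uIcc_of_ge hs] at hr
    exact Real.smoothTransition.zero_of_nonpos hr.2
  rw [smoothRamp, intervalIntegral.integral_congr h]
  simp

protected theorem nonneg (s : ℝ) : 0 ≤ smoothRamp s := by
  rcases le_total s 0 with hs | hs
  · exact (eq_zero_of_nonpos hs).ge
  · exact (eq_zero_of_nonpos le_rfl).ge.trans (monotone hs)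

theorem antitone_sub_id : Antitone fun s => smoothRamp s - s := by
  refine antitone_of_deriv_nonpos
    (fun s => ((hasDerivAt s).sub (hasDerivAt_id s)).differentiableAt) fun s => ?_
  have h := ((hasDerivAt s).sub (hasDerivAt_id s)).deriv
  have h' : deriv (fun s => smoothRamp s - s) s = Real.smoothTransition s - 1 := h
  rw [h']
  linarith [Real.smoothTransition.le_one s]

theorem le_self {s : ℝ} (hs : 0 ≤ s) : smoothRamp s ≤ s := by
  have h := antitone_sub_id hs
  simp only [eq_zero_of_nonpos le_rfl] at h
  linarith

theorem eq_of_one_le {s : ℝ} (hs : 1 ≤ s) : smoothRamp s = smoothRamp 1 + (s - 1) := by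
  have hi (a b : ℝ) : IntervalIntegrable Real.smoothTransition volume a b :=
    Real.smoothTransition.continuous.intervalIntegrable a b
  have h : Set.EqOn Real.smoothTransition (fun _ => (1 : ℝ)) (Set.uIcc 1 s) := fun r hr => by
    rw [Set.uIcc_of_le hs] at hr
    exact Real.smoothTransition.one_of_one_le hr.1
  have h1 : ∫ r in (1 : ℝ)..s, Real.smoothTransition r = s - 1 := by
    rw [intervalIntegral.integral_congr h]
    simp
  rw [smoothRamp, smoothRamp, ← intervalIntegral.integral_add_adjacent_intervals (hi 0 1) (hi 1 s),
    h1]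

/-- Truncating a function from below by the smooth ramp gives a convex function as soon as the
function has nonnegative second derivative above the truncation level. -/
theorem convexOn_comp_sub {w : ℝ → ℝ} {T : ℝ} (hw : ContDiff ℝ (⊤ : ℕ∞) w)
    (h : ∀ t, T < w t → 0 ≤ deriv (deriv w) t) :
    ConvexOn ℝ Set.univ fun t => smoothRamp (w t - T) := by
  have hw' := contDiff_infty_iff_deriv.1 hw
  have hw'' := contDiff_infty_iff_deriv.1 hw'.2
  have d1 (t : ℝ) : HasDerivAt (fun t => smoothRamp (w t - T))
      (Real.smoothTransition (w t - T) * deriv w t) t :=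
    HasDerivAt.comp (h := fun t => w t - T) t (hasDerivAt (w t - T)) ((hw'.1 t).hasDerivAt.sub_const T)
  have e1 : deriv (fun t => smoothRamp (w t - T)) =
      fun t => Real.smoothTransition (w t - T) * deriv w t := funext fun t => (d1 t).deriv
  have hσ : Differentiable ℝ Real.smoothTransition :=
    (Real.smoothTransition.contDiff (n := 1)).differentiable (by simp)
  have d2 (t : ℝ) : HasDerivAt (fun t => Real.smoothTransition (w t - T) * deriv w t)
      (deriv Real.smoothTransition (w t - T) * deriv w t * deriv w t +
        Real.smoothTransition (w t - T) * deriv (deriv w) t) t :=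
    (HasDerivAt.comp (h := fun t => w t - T) t (hσ (w t - T)).hasDerivAt ((hw'.1 t).hasDerivAt.sub_const T)).fun_mul
      (hw''.1 t).hasDerivAt
  refine convexOn_univ_of_deriv2_nonneg (fun t => (d1 t).differentiableAt) ?_ fun t => ?_
  · rw [e1]
    exact fun t => (d2 t).differentiableAt
  · have e2 : deriv^[2] (fun t => smoothRamp (w t - T)) t =
        deriv (deriv fun t => smoothRamp (w t - T)) t := rfl
    rw [e2, e1, (d2 t).deriv, mul_assoc]
    refine add_nonneg (mul_nonneg (Real.smoothTransition.monotone.deriv_nonneg)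
      (mul_self_nonneg _)) ?_
    rcases le_or_gt (w t) T with ht | ht
    · rw [Real.smoothTransition.zero_of_nonpos (by linarith), zero_mul]
    · exact mul_nonneg (Real.smoothTransition.nonneg _) (h t ht)

end smoothRamp

/-- The second derivative of a finite product of nonvanishing functions, in terms of logarithmic
derivatives. -/
theorem deriv_deriv_prod {ι : Type*} [Fintype ι] {g d : ι → ℝ → ℝ} {c : ι → ℝ} {t : ℝ}
    (hg : ∀ i s, HasDerivAt (g i) (d i s) s) (hd : ∀ i, HasDerivAt (d i) (c i) t)
    (h0 : ∀ i, g i t ≠ 0) :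
    deriv (deriv fun s => ∏ i, g i s) t = (∏ i, g i t) *
      ((∑ i, d i t / g i t) ^ 2 + ∑ i, (c i / g i t - (d i t / g i t) ^ 2)) := by
  classical
  have hP (s : ℝ) (hs : ∀ i, g i s ≠ 0) : HasDerivAt (fun s => ∏ i, g i s)
      ((∏ i, g i s) * ∑ i, d i s / g i s) s := by
    refine (HasDerivAt.fun_finsetProd fun i _ => hg i s).congr_deriv ?_
    rw [Finset.mul_sum]
    refine Finset.sum_congr rfl fun i _ => ?_
    rw [← Finset.mul_prod_erase _ (fun j => g j s) (Finset.mem_univ i), smul_eq_mul]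
    field_simp [hs i]
  have hev : ∀ᶠ s in nhds t, ∀ i, g i s ≠ 0 :=
    Filter.eventually_all.2 fun i => (hg i t).continuousAt.eventually_ne (h0 i)
  have heq : deriv (fun s => ∏ i, g i s) =ᶠ[nhds t]
      fun s => (∏ i, g i s) * ∑ i, d i s / g i s :=
    hev.mono fun s hs => (hP s hs).deriv
  have hS : HasDerivAt (fun s => ∑ i, d i s / g i s)
      (∑ i, (c i / g i t - (d i t / g i t) ^ 2)) t := by
    refine (HasDerivAt.fun_sum fun i _ => (hd i).div (hg i t) (h0 i)).congr_deriv ?_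
    refine Finset.sum_congr rfl fun i _ => ?_
    have := h0 i
    field_simp
  rw [heq.deriv_eq, ((hP t h0).fun_mul hS).deriv]
  ring

section InnerProductSpace

variable {E : Type*} [NormedAddCommGroup E] [InnerProductSpace ℝ E]

/-- The algebraic inequality behind the positivity of the Hessian of `∏ i, ‖u - α i‖ ^ 2` at
points far away from the wells. -/
theorem logHessian_nonneg {ι : Type*} [Fintype ι] [Nonempty ι] (y : ι → E) (v : E) {D : ℝ}
    (hD : ∀ i j, ‖y i - y j‖ ≤ D) (h0 : ∀ i, y i ≠ 0)
    (hy : ∀ i, D ^ 2 * Fintype.card ι ≤ ‖y i‖ ^ 2) :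
    0 ≤ (∑ i, 2 * inner ℝ (y i) v / ‖y i‖ ^ 2) ^ 2 +
      ∑ i, (2 * ‖v‖ ^ 2 / ‖y i‖ ^ 2 - (2 * inner ℝ (y i) v / ‖y i‖ ^ 2) ^ 2) := by
  set b : ι → ℝ := fun i => inner ℝ (y i) v / ‖y i‖ ^ 2 with hb
  have hpos (i : ι) : 0 < ‖y i‖ := norm_pos_iff.2 (h0 i)
  have hdiff (i j : ι) : (b i - b j) ^ 2 ≤ ‖v‖ ^ 2 * D ^ 2 / (‖y i‖ ^ 2 * ‖y j‖ ^ 2) := by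
    have e : b i - b j =
        inner ℝ ((1 / ‖y i‖) ^ 2 • y i - (1 / ‖y j‖) ^ 2 • y j) v := by
      simp only [hb, inner_sub_left, real_inner_smul_left]
      ring
    have h1 := abs_real_inner_le_norm ((1 / ‖y i‖) ^ 2 • y i - (1 / ‖y j‖) ^ 2 • y j) v
    rw [← e, ← dist_eq_norm, dist_div_norm_sq_smul (h0 i) (h0 j), dist_eq_norm] at h1
    have h2 : |b i - b j| ≤ 1 ^ 2 / (‖y i‖ * ‖y j‖) * D * ‖v‖ := by
      refine h1.trans ?_
      have := hpos i
      have := hpos j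
      gcongr
      exact hD i j
    calc (b i - b j) ^ 2 = |b i - b j| ^ 2 := (sq_abs _).symm
      _ ≤ (1 ^ 2 / (‖y i‖ * ‖y j‖) * D * ‖v‖) ^ 2 := by gcongr
      _ = _ := by ring
  have hrow (i : ι) : ∑ j, (b i - b j) ^ 2 ≤ ‖v‖ ^ 2 / ‖y i‖ ^ 2 := by
    have hc : (0 : ℝ) < Fintype.card ι := by exact_mod_cast Fintype.card_pos
    have hj (j : ι) : (b i - b j) ^ 2 ≤ ‖v‖ ^ 2 / ‖y i‖ ^ 2 / Fintype.card ι := by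
      refine (hdiff i j).trans ?_
      have := hpos i
      have := hpos j
      rw [div_div, div_le_div_iff₀ (by positivity) (by positivity)]
      have := mul_le_mul_of_nonneg_left (hy j) (by positivity : 0 ≤ ‖v‖ ^ 2 * ‖y i‖ ^ 2)
      linarith
    refine (Finset.sum_le_sum fun j _ => hj j).trans_eq ?_
    rw [Finset.sum_const, Finset.card_univ, nsmul_eq_mul]
    field_simp
  have hsum : ∑ i, ∑ j, (b i - b j) ^ 2 =
      2 * (Fintype.card ι * ∑ i, b i ^ 2) - 2 * (∑ i, b i) ^ 2 := by
    have e (i j : ι) : (b i - b j) ^ 2 = b i ^ 2 + b j ^ 2 - 2 * (b i * b j) := by ring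
    simp only [e, Finset.sum_sub_distrib, Finset.sum_add_distrib, ← Finset.mul_sum,
      Finset.sum_const, Finset.card_univ, nsmul_eq_mul, ← Finset.sum_mul]
    ring
  have htot := Finset.sum_le_sum fun i (_ : i ∈ Finset.univ) => hrow i
  rw [hsum] at htot
  have hcard : (1 : ℝ) ≤ Fintype.card ι := by exact_mod_cast Fintype.card_pos
  have hsq : 0 ≤ ∑ i, b i ^ 2 := Finset.sum_nonneg fun i _ => sq_nonneg _
  have e1 : ∑ i, 2 * inner ℝ (y i) v / ‖y i‖ ^ 2 = 2 * ∑ i, b i := by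
    simp only [hb, Finset.mul_sum, mul_div_assoc]
  have e2 : ∑ i, (2 * ‖v‖ ^ 2 / ‖y i‖ ^ 2 - (2 * inner ℝ (y i) v / ‖y i‖ ^ 2) ^ 2) =
      2 * ∑ i, ‖v‖ ^ 2 / ‖y i‖ ^ 2 - 4 * ∑ i, b i ^ 2 := by
    rw [Finset.sum_sub_distrib, Finset.mul_sum]
    congr 1
    · exact Finset.sum_congr rfl fun _ _ => by ring
    · rw [Finset.mul_sum]
      exact Finset.sum_congr rfl fun _ _ => by simp only [hb]; ring
  rw [e1, e2]
  nlinarith [mul_nonneg (sub_nonneg.2 hcard) hsq]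

theorem contDiff_prod_norm_sub_sq {ι : Type*} [Fintype ι] (α : ι → E) :
    ContDiff ℝ (⊤ : ℕ∞) fun u : E => ∏ i, ‖u - α i‖ ^ 2 :=
  contDiff_prod fun _ _ => (contDiff_id.sub contDiff_const).norm_sq ℝ

/-- Along any line, the multiwell potential has nonnegative second derivative at points far away
from the wells. -/
theorem deriv_deriv_prod_norm_sub_sq_nonneg {ι : Type*} [Fintype ι] [Nonempty ι] (α : ι → E)
    (x v : E) (t : ℝ) {D : ℝ} (hD : ∀ i j, ‖α i - α j‖ ≤ D) (h0 : ∀ i, x + t • v ≠ α i)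
    (hy : ∀ i, D ^ 2 * Fintype.card ι ≤ ‖x + t • v - α i‖ ^ 2) :
    0 ≤ deriv (deriv fun s : ℝ => ∏ i, ‖x + s • v - α i‖ ^ 2) t := by
  have hl (i : ι) (s : ℝ) : HasDerivAt (fun s : ℝ => x + s • v - α i) v s := by
    simpa using (((hasDerivAt_id s).smul_const v).const_add x).sub_const (α i)
  have hd (i : ι) : HasDerivAt (fun s : ℝ => 2 * inner ℝ (x + s • v - α i) v)
      (2 * ‖v‖ ^ 2) t := by
    refine (((hl i t).inner ℝ (hasDerivAt_const t v)).const_mul 2).congr_deriv ?_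
    rw [inner_zero_right, zero_add, real_inner_self_eq_norm_sq]
  have hne (i : ι) : x + t • v - α i ≠ 0 := sub_ne_zero.2 (h0 i)
  rw [deriv_deriv_prod (fun i s => (hl i s).norm_sq) hd
    fun i => pow_ne_zero 2 (norm_ne_zero_iff.2 (hne i))]
  refine mul_nonneg (Finset.prod_nonneg fun i _ => sq_nonneg _)
    (logHessian_nonneg (fun i => x + t • v - α i) v (D := D) (fun i j => ?_) hne hy)
  rw [sub_sub_sub_cancel_left, norm_sub_rev]
  exact hD i j

/-- The multiwell potential, truncated from below at a level exceeding all its values at points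
near the wells, is convex. -/
theorem convexOn_smoothRamp_prod_norm_sub_sq {ι : Type*} [Fintype ι] [Nonempty ι] (α : ι → E)
    {D T : ℝ} (hD : ∀ i j, ‖α i - α j‖ ≤ D) (h0 : ∀ i u, T < ∏ j, ‖u - α j‖ ^ 2 → u ≠ α i)
    (hy : ∀ i u, T < ∏ j, ‖u - α j‖ ^ 2 → D ^ 2 * Fintype.card ι ≤ ‖u - α i‖ ^ 2) :
    ConvexOn ℝ Set.univ fun u : E => smoothRamp (∏ i, ‖u - α i‖ ^ 2 - T) := by
  refine ⟨convex_univ, fun x _ y _ a b ha hb hab => ?_⟩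
  have hw : ContDiff ℝ (⊤ : ℕ∞) fun s : ℝ => ∏ i, ‖x + s • (y - x) - α i‖ ^ 2 :=
    (contDiff_prod_norm_sub_sq α).comp
      (contDiff_const.add (contDiff_id.smul contDiff_const))
  have hline := (smoothRamp.convexOn_comp_sub hw fun t ht =>
    deriv_deriv_prod_norm_sub_sq_nonneg α x (y - x) t hD (fun i => h0 i _ ht)
      fun i => hy i _ ht).2 (Set.mem_univ 0) (Set.mem_univ 1) ha hb hab
  have e : a • x + b • y = x + b • (y - x) := by
    rw [← sub_eq_iff_eq_add.2 hab.symm]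
    module
  simpa [e] using hline

end InnerProductSpace

/-- **Decomposition of the multiwell potential into a convex part and a perturbation with
bounded Hessian.** For pairwise distinct `α_1, …, α_P ∈ ℝ^N` and
`W(u) = ∏ᵢ |u - αᵢ|²`, there exist smooth nonnegative `W_conv, W_pert : ℝ^N → [0,∞)` with
`W = W_conv + W_pert`, `W_conv` convex, and `sup_u ‖∇²W_pert(u)‖ < ∞`. -/
theorem multiwell_potential_decomposition
    {N P : ℕ} (hP : 1 ≤ P) (α : Fin P → EuclideanSpace ℝ (Fin N))
    (hα : Function.Injective α)
    (W : EuclideanSpace ℝ (Fin N) → ℝ)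
    (hW : ∀ u, W u = ∏ i : Fin P, ‖u - α i‖ ^ 2) :
    ∃ Wconv Wpert : EuclideanSpace ℝ (Fin N) → ℝ,
      ContDiff ℝ (⊤ : ℕ∞) Wconv ∧ ContDiff ℝ (⊤ : ℕ∞) Wpert ∧
      (∀ u, 0 ≤ Wconv u) ∧ (∀ u, 0 ≤ Wpert u) ∧
      (∀ u, W u = Wconv u + Wpert u) ∧
      ConvexOn ℝ Set.univ Wconv ∧
      ∃ M : ℝ, ∀ u, ‖iteratedFDeriv ℝ 2 Wpert u‖ ≤ M := by
  have : Nonempty (Fin P) := ⟨⟨0, hP⟩⟩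
  obtain rfl : W = fun u => ∏ i, ‖u - α i‖ ^ 2 := funext hW
  have hWs := contDiff_prod_norm_sub_sq α
  have hW0 (u : EuclideanSpace ℝ (Fin N)) : 0 ≤ ∏ i, ‖u - α i‖ ^ 2 :=
    Finset.prod_nonneg fun i _ => sq_nonneg _
  obtain ⟨A, hA⟩ : ∃ A, ∀ i, ‖α i‖ ≤ A :=
    ⟨∑ i, ‖α i‖, fun i =>
      Finset.single_le_sum (f := fun i => ‖α i‖) (fun _ _ => norm_nonneg _) (Finset.mem_univ i)⟩
  have hfar {r : ℝ} (u : EuclideanSpace ℝ (Fin N)) (hu : A + r < ‖u‖) (i : Fin P) :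
      r < ‖u - α i‖ := by
    linarith [norm_sub_norm_le u (α i), hA i]
  have hD (i j : Fin P) : ‖α i - α j‖ ≤ 2 * A := by
    linarith [norm_sub_le (α i) (α j), hA i, hA j]
  set K : ℝ := (2 * A) ^ 2 * Fintype.card (Fin P) with hK
  have hK0 : 0 ≤ K := by positivity
  obtain ⟨T, hT⟩ := (isCompact_closedBall (0 : EuclideanSpace ℝ (Fin N))
    (A + (K + 1))).exists_bound_of_continuousOn hWs.continuous.continuousOn
  have hT0 : 0 ≤ T ⊔ 0 := le_sup_right
  have hout (u : EuclideanSpace ℝ (Fin N)) (hu : T ⊔ 0 < ∏ i, ‖u - α i‖ ^ 2) (i : Fin P) :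
      K + 1 < ‖u - α i‖ := by
    refine hfar u (lt_of_not_ge fun h => ?_) i
    have := (le_abs_self _).trans (hT u (mem_closedBall_zero_iff.2 h))
    exact absurd (hu.trans_le this) (not_lt.2 le_sup_left)
  generalize T ⊔ 0 = T at hT0 hout
  have hcs : ContDiff ℝ (⊤ : ℕ∞) fun u : EuclideanSpace ℝ (Fin N) =>
      smoothRamp (∏ i, ‖u - α i‖ ^ 2 - T) :=
    smoothRamp.contDiff.comp (hWs.sub contDiff_const)
  have hps := hWs.sub hcs
  refine ⟨fun u => smoothRamp (∏ i, ‖u - α i‖ ^ 2 - T),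
    fun u => ∏ i, ‖u - α i‖ ^ 2 - smoothRamp (∏ i, ‖u - α i‖ ^ 2 - T), hcs, hps,
    fun u => smoothRamp.nonneg _, fun u => sub_nonneg.2 ?_, fun u => by ring, ?_, ?_⟩
  · exact (smoothRamp.monotone (sub_le_self _ hT0)).trans (smoothRamp.le_self (hW0 u))
  · refine convexOn_smoothRamp_prod_norm_sub_sq α hD (fun i u hu h => ?_) fun i u hu => ?_
    · have := hout u hu i
      rw [h, sub_self, norm_zero] at this
      linarith
    · have := hout u hu i
      nlinarith
  · obtain ⟨M, hM⟩ := (isCompact_closedBall (0 : EuclideanSpace ℝ (Fin N))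
      (A + (T + 2))).exists_bound_of_continuousOn
      (hps.continuous_iteratedFDeriv (m := 2) (WithTop.coe_le_coe.2 le_top)).continuousOn
    refine ⟨M ⊔ 0, fun u => ?_⟩
    rcases le_or_gt ‖u‖ (A + (T + 2)) with hu | hu
    · exact (hM u (mem_closedBall_zero_iff.2 hu)).trans le_sup_left
    · have hlt : T + 1 < ∏ i, ‖u - α i‖ ^ 2 :=
        calc T + 1 < T + 2 := by linarith
          _ ≤ (T + 2) ^ P := le_self_pow₀ (by linarith) (by omega)
          _ = ∏ _i : Fin P, (T + 2) := by simp
          _ ≤ _ := by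
            refine Finset.prod_le_prod (fun i _ => by linarith) fun i _ => ?_
            nlinarith [hfar u hu i]
      have hev : (fun u => ∏ i, ‖u - α i‖ ^ 2 - smoothRamp (∏ i, ‖u - α i‖ ^ 2 - T)) =ᶠ[nhds u]
          fun _ => T + 1 - smoothRamp 1 := by
        filter_upwards [hWs.continuous.continuousAt.eventually_const_lt hlt] with z hz
        rw [smoothRamp.eq_of_one_le (by linarith)]
        ring
      rw [(hev.iteratedFDeriv ℝ 2).eq_of_nhds, iteratedFDeriv_const_of_ne two_ne_zero]
      simp
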